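/- Let R = [r] × [s]. Then birational rowmotion ρ : ℝ_{>0}^R → ℝ_{>0}^R satisfies ρ^{r+s}(y) = y for every y ∈ ℝ_{>0}^R; that is, the action of birational rowmotion on the rectangle R has order dividing r + s. -/

import Mathlib

namespace Paper

/-- Membership in the rectangle poset `R = [1,r] × [1,s]` (coordinates in `ℤ`). -/
def inR (r s : ℕ) (p : ℤ × ℤ) : Prop :=
  1 ≤ p.1 ∧ p.1 ≤ (r : ℤ) ∧ 1 ≤ p.2 ∧ p.2 ≤ (s : ℤ)

instance (r s : ℕ) : DecidablePred (inR r s) := fun _ => by unfold inR; infer_instance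

/-- The cover relation in the product of two chains. -/
def CoverStep (p q : ℤ × ℤ) : Prop :=
  (q.1 = p.1 + 1 ∧ q.2 = p.2) ∨ (q.1 = p.1 ∧ q.2 = p.2 + 1)

/-- Upper covers of `p` inside the rectangle. -/
def upSet (r s : ℕ) (p : ℤ × ℤ) : Finset (ℤ × ℤ) :=
  ({(p.1 + 1, p.2), (p.1, p.2 + 1)} : Finset (ℤ × ℤ)).filter (inR r s)

/-- Lower covers of `p` inside the rectangle. -/
def downSet (r s : ℕ) (p : ℤ × ℤ) : Finset (ℤ × ℤ) :=
  ({(p.1 - 1, p.2), (p.1, p.2 - 1)} : Finset (ℤ × ℤ)).filter (inR r s)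

/-- Sum of the labels of the lower covers of `p` (empty sum = 1). -/
noncomputable def dsum (r s : ℕ) (x : ℤ × ℤ → ℝ) (p : ℤ × ℤ) : ℝ :=
  if (downSet r s p).Nonempty then ∑ q ∈ downSet r s p, x q else 1

/-- Parallel sum of the labels of the upper covers of `p` (empty parallel sum = 1). -/
noncomputable def usum (r s : ℕ) (x : ℤ × ℤ → ℝ) (p : ℤ × ℤ) : ℝ :=
  if (upSet r s p).Nonempty then (∑ q ∈ upSet r s p, (x q)⁻¹)⁻¹ else 1

/-- The birational toggle at `p`. -/
noncomputable def toggle (r s : ℕ) (p : ℤ × ℤ) (x : ℤ × ℤ → ℝ) : ℤ × ℤ → ℝ :=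
  fun q => if q = p then usum r s x p * dsum r s x p / x p else x q

/-- The elements of `[1,a] × [1,b]` listed from top to bottom
(descending lexicographic order, the reverse of a linear extension). -/
def rectList (a b : ℕ) : List (ℤ × ℤ) :=
  (List.range a).reverse.flatMap fun i =>
    (List.range b).reverse.map fun j => ((i : ℤ) + 1, (j : ℤ) + 1)

/-- Birational rowmotion on the rectangle: toggles from top to bottom. -/
noncomputable def rho (r s : ℕ) (x : ℤ × ℤ → ℝ) : ℤ × ℤ → ℝ :=
  (rectList r s).foldl (fun y p => toggle r s p y) x

/-- Inverse birational rowmotion: toggles from bottom to top. -/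
noncomputable def rhoInv (r s : ℕ) (x : ℤ × ℤ → ℝ) : ℤ × ℤ → ℝ :=
  (rectList r s).reverse.foldl (fun y p => toggle r s p y) x

/-- Integer powers of birational rowmotion. -/
noncomputable def rhoPow (r s : ℕ) (k : ℤ) (x : ℤ × ℤ → ℝ) : ℤ × ℤ → ℝ :=
  if 0 ≤ k then (rho r s)^[k.toNat] x else (rhoInv r s)^[(-k).toNat] x

/-- Saturated chains from `a` to `b`, as lists of successive cover steps. -/
def ChainList (a b : ℤ × ℤ) : Type :=
  {l : List (ℤ × ℤ) // l.Chain' CoverStep ∧ l.head? = some a ∧ l.getLast? = some b}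

/-- The inverse birational transfer map on the rectangle: `φ⁻¹(x)_p` is the total weight
of all saturated chains from the minimal element `(1,1)` to `p`. -/
noncomputable def phiInv (x : ℤ × ℤ → ℝ) : ℤ × ℤ → ℝ :=
  fun p => ∑ᶠ c : ChainList (1, 1) p, (c.1.map x).prod

/-- The birational transfer map `φ(x)_p = x_p / ∑_{q ⋖ p} x_q`. -/
noncomputable def phi (r s : ℕ) (x : ℤ × ℤ → ℝ) : ℤ × ℤ → ℝ :=
  fun p => x p / dsum r s x p

/-- A collection of `k` pairwise vertex-disjoint lattice paths in the interval
`[i₁,i₂] × [j₁,j₂]`, from `(i₁,j₁),…,(i₁,j₁+k-1)` to `(i₂,j₂-k+1),…,(i₂,j₂)`. -/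
structure RSys (i₁ i₂ j₁ j₂ : ℤ) (k : ℕ) where
  path : Fin k → List (ℤ × ℤ)
  chain : ∀ t, (path t).Chain' CoverStep
  mem : ∀ t, ∀ v ∈ path t, i₁ ≤ v.1 ∧ v.1 ≤ i₂ ∧ j₁ ≤ v.2 ∧ v.2 ≤ j₂
  first : ∀ t : Fin k, (path t).head? = some (i₁, j₁ + ((t : ℕ) : ℤ))
  final : ∀ t : Fin k, (path t).getLast? = some (i₂, j₂ - k + 1 + ((t : ℕ) : ℤ))
  disjoint : ∀ t t' : Fin k, t ≠ t' → ∀ v ∈ path t, v ∉ path t'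

/-- The weight of a collection of paths: the product of labels of all its elements. -/
noncomputable def RSysWeight (x : ℤ × ℤ → ℝ) {i₁ i₂ j₁ j₂ : ℤ} {k : ℕ}
    (L : RSys i₁ i₂ j₁ j₂ k) : ℝ :=
  ∏ t : Fin k, ((L.path t).map x).prod

/-- `w_I^{(k)}(x)`: total weight of all collections of `k` nonintersecting paths in the
interval `I = [i₁,i₂] × [j₁,j₂]` (with `w_I^{(0)} = 1`). -/
noncomputable def w (i₁ i₂ j₁ j₂ : ℤ) (k : ℤ) (x : ℤ × ℤ → ℝ) : ℝ :=
  if k ≤ 0 then 1 else ∑ᶠ L : RSys i₁ i₂ j₁ j₂ k.toNat, RSysWeight x L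

/-- `w_I(x)`: the product of all labels in the interval `I = [i₁,i₂] × [j₁,j₂]`. -/
noncomputable def wProd (i₁ i₂ j₁ j₂ : ℤ) (x : ℤ × ℤ → ℝ) : ℝ :=
  ∏ p ∈ Finset.Icc i₁ i₂ ×ˢ Finset.Icc j₁ j₂, x p

/-- The directed edges of the graph `𝒢_R` on vertex set `[1,r+1] × [1,s]`:
`(i,j) → (i+1,j)` for `(i,j) ∈ R`, and `(i,j) → (i+1,j-1)` when valid. -/
def GEdge (r s : ℕ) (p q : ℤ × ℤ) : Prop :=
  1 ≤ p.1 ∧ p.1 ≤ (r : ℤ) ∧ 1 ≤ p.2 ∧ p.2 ≤ (s : ℤ) ∧ q.1 = p.1 + 1 ∧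
    (q.2 = p.2 ∨ (q.2 = p.2 - 1 ∧ 2 ≤ p.2))

/-- The weight of an edge of `𝒢_R`: `x_p⁻¹` for vertical edges, `1` for diagonal ones. -/
noncomputable def edgeWt (x : ℤ × ℤ → ℝ) (p q : ℤ × ℤ) : ℝ :=
  if q.2 = p.2 then (x p)⁻¹ else 1

/-- The weight of a directed path in `𝒢_R`, given as its list of vertices. -/
noncomputable def listWt (x : ℤ × ℤ → ℝ) (l : List (ℤ × ℤ)) : ℝ :=
  ((l.zip l.tail).map fun e => edgeWt x e.1 e.2).prod

/-- The boundary vertex `P_t` of `𝒢_R`: `P_j = (1,j)` for `1 ≤ j ≤ s`, `P_{s+i} = (i+1,s)`. -/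
def Pvert (s : ℕ) (t : ℤ) : ℤ × ℤ := if t ≤ (s : ℤ) then (1, t) else (t - s + 1, (s : ℤ))

/-- The boundary vertex `Q_t` of `𝒢_R`: `Q_i = (i,1)` for `1 ≤ i ≤ r`, `Q_{r+j} = (r+1,j)`. -/
def Qvert (r : ℕ) (t : ℤ) : ℤ × ℤ := if t ≤ (r : ℤ) then (t, 1) else ((r : ℤ) + 1, t - r)

/-- A collection of `k` pairwise vertex-disjoint directed paths in `𝒢_R` from
`{P_i, …, P_{i+k-1}}` to `{Q_j, …, Q_{j+k-1}}`. -/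
structure GSys (r s : ℕ) (i j : ℤ) (k : ℕ) where
  perm : Equiv.Perm (Fin k)
  path : Fin k → List (ℤ × ℤ)
  chain : ∀ t, (path t).Chain' (GEdge r s)
  first : ∀ t : Fin k, (path t).head? = some (Pvert s (i + ((t : ℕ) : ℤ)))
  final : ∀ t : Fin k, (path t).getLast? = some (Qvert r (j + (((perm t) : ℕ) : ℤ)))
  disjoint : ∀ t t' : Fin k, t ≠ t' → ∀ v ∈ path t, v ∉ path t'

/-- The weight of a collection of paths in `𝒢_R`: the product of the weights of all
edges used. -/
noncomputable def GSysWeight (x : ℤ × ℤ → ℝ) {r s : ℕ} {i j : ℤ} {k : ℕ}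
    (L : GSys r s i j k) : ℝ :=
  ∏ t : Fin k, listWt x (L.path t)

/-- `W_{ij}^{(k)}(x)`: total weight of all collections of `k` nonintersecting paths in
`𝒢_R` from `{P_i,…,P_{i+k-1}}` to `{Q_j,…,Q_{j+k-1}}`; `W_{ij}^{(0)} = 1`, and `0` when an
out-of-range index occurs. -/
noncomputable def W (r s : ℕ) (x : ℤ × ℤ → ℝ) (i j k : ℤ) : ℝ :=
  if k < 0 then 0
  else if k = 0 then 1
  else if 1 ≤ i ∧ 1 ≤ j ∧ i + k - 1 ≤ (r : ℤ) + s ∧ j + k - 1 ≤ (r : ℤ) + s then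
    ∑ᶠ L : GSys r s i j k.toNat, GSysWeight x L
  else 0

/-! ### Rowmotion as a recurrence -/

theorem foldl_toggle_of_notMem (r s : ℕ) (l : List (ℤ × ℤ)) (x : ℤ × ℤ → ℝ) (q : ℤ × ℤ)
    (hq : q ∉ l) : l.foldl (fun y p => toggle r s p y) x q = x q := by
  induction l generalizing x with
  | nil => rfl
  | cons a l ih =>
    simp only [List.mem_cons, not_or] at hq
    rw [List.foldl_cons, ih _ hq.2]
    simp [toggle, hq.1]

theorem rectList_eq (a b : ℕ) :
    rectList a b = (List.range a).reverse.flatMap fun i : ℕ =>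
      (List.range b).reverse.map fun j : ℕ => ((i : ℤ) + 1, (j : ℤ) + 1) := by
  simp [rectList, ← List.map_eq_flatMap, -List.map_reverse, List.flatMap_map,
    Function.comp_def]

theorem mem_rectList (r s : ℕ) (p : ℤ × ℤ) : p ∈ rectList r s ↔ inR r s p := by
  obtain ⟨a, b⟩ := p
  simp only [rectList_eq, List.mem_flatMap, List.mem_reverse, List.mem_range, List.mem_map,
    Prod.mk.injEq, inR]
  constructor
  · rintro ⟨i, hi, j, hj, rfl, rfl⟩
    omega
  · rintro ⟨h1, h2, h3, h4⟩
    exact ⟨(a - 1).toNat, by omega, (b - 1).toNat, by omega, by omega, by omega⟩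

theorem rectList_pairwise (r s : ℕ) :
    (rectList r s).Pairwise fun p q => q.1 < p.1 ∨ q.1 = p.1 ∧ q.2 < p.2 := by
  rw [rectList_eq, List.pairwise_flatMap]
  constructor
  · intro i _
    rw [List.pairwise_map, List.pairwise_reverse]
    refine List.pairwise_lt_range.imp ?_
    intro a b hab
    right
    constructor <;> simp
    omega
  · rw [List.pairwise_reverse]
    refine List.pairwise_lt_range.imp ?_
    intro a b hab p hp q hq
    simp only [List.mem_map] at hp hq
    obtain ⟨_, _, rfl⟩ := hp
    obtain ⟨_, _, rfl⟩ := hq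
    left
    simp
    omega

theorem dsum_congr (r s : ℕ) (x y : ℤ × ℤ → ℝ) (p : ℤ × ℤ)
    (h : ∀ q ∈ downSet r s p, x q = y q) : dsum r s x p = dsum r s y p := by
  unfold dsum
  rw [Finset.sum_congr rfl h]

theorem usum_congr (r s : ℕ) (x y : ℤ × ℤ → ℝ) (p : ℤ × ℤ)
    (h : ∀ q ∈ upSet r s p, x q = y q) : usum r s x p = usum r s y p := by
  unfold usum
  rw [Finset.sum_congr rfl fun q hq => by rw [h q hq]]

theorem rho_apply (r s : ℕ) (x : ℤ × ℤ → ℝ) (p : ℤ × ℤ) (hp : inR r s p) :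
    rho r s x p = usum r s (rho r s x) p * dsum r s x p / x p := by
  obtain ⟨l₁, l₂, hl⟩ := List.append_of_mem ((mem_rectList r s p).2 hp)
  have hpw := rectList_pairwise r s
  rw [hl, List.pairwise_append, List.pairwise_cons] at hpw
  obtain ⟨_, ⟨h₂, _⟩, h₁⟩ := hpw
  set z := l₁.foldl (fun y p => toggle r s p y) x with hz
  have hrho : rho r s x = l₂.foldl (fun y p => toggle r s p y) (toggle r s p z) := by
    rw [rho, hl, List.foldl_append, List.foldl_cons]
  have hp₁ : p ∉ l₁ := fun h => by
    have := h₁ p h p (by simp)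
    omega
  have hp₂ : p ∉ l₂ := fun h => by
    have := h₂ p h
    omega
  have hd : dsum r s z p = dsum r s x p := by
    refine dsum_congr r s _ _ p fun q hq => foldl_toggle_of_notMem r s _ _ _ fun h => ?_
    have := h₁ q h p (by simp)
    simp only [downSet, Finset.mem_filter, Finset.mem_insert, Finset.mem_singleton] at hq
    rcases hq.1 with rfl | rfl <;> simp at this <;> omega
  have hu : usum r s (rho r s x) p = usum r s z p := by
    refine usum_congr r s _ _ p fun q hq => ?_
    simp only [upSet, Finset.mem_filter, Finset.mem_insert, Finset.mem_singleton] at hq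
    have hq₂ : q ∉ l₂ := fun h => by
      have := h₂ q h
      rcases hq.1 with rfl | rfl <;> simp at this
    have hqp : q ≠ p := by
      rintro rfl
      rcases hq.1 with h | h <;> simp [Prod.ext_iff] at h
    rw [hrho, foldl_toggle_of_notMem r s _ _ _ hq₂]
    simp [toggle, hqp]
  rw [hu, hrho, foldl_toggle_of_notMem r s _ _ _ hp₂]
  simp only [toggle, if_true]
  rw [hd, hz, foldl_toggle_of_notMem r s _ _ _ hp₁]

theorem dsum_pos (r s : ℕ) (x : ℤ × ℤ → ℝ) (hx : ∀ p, inR r s p → 0 < x p) (p : ℤ × ℤ) :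
    0 < dsum r s x p := by
  unfold dsum
  split_ifs with h
  · exact Finset.sum_pos (fun q hq => hx q (Finset.mem_filter.1 hq).2) h
  · exact one_pos

theorem usum_pos (r s : ℕ) (x : ℤ × ℤ → ℝ) (p : ℤ × ℤ)
    (hx : ∀ q ∈ upSet r s p, 0 < x q) : 0 < usum r s x p := by
  unfold usum
  split_ifs with h
  · exact inv_pos.2 (Finset.sum_pos (fun q hq => inv_pos.2 (hx q hq)) h)
  · exact one_pos

theorem rho_pos (r s : ℕ) (x : ℤ × ℤ → ℝ) (hx : ∀ p, inR r s p → 0 < x p) (p : ℤ × ℤ)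
    (hp : inR r s p) : 0 < rho r s x p := by
  obtain ⟨n, hn⟩ : ∃ n : ℕ, r + s - p.1 - p.2 = n :=
    ⟨(r + s - p.1 - p.2).toNat, by unfold inR at hp; omega⟩
  induction n using Nat.strong_induction_on generalizing p with
  | _ n ih =>
    rw [rho_apply r s x p hp]
    refine div_pos (mul_pos (usum_pos r s _ p fun q hq => ?_) (dsum_pos r s x hx p)) (hx p hp)
    simp only [upSet, Finset.mem_filter, Finset.mem_insert, Finset.mem_singleton] at hq
    have hR := hq.2
    unfold inR at hR
    refine ih (n - 1) ?_ q hq.2 ?_ <;> rcases hq.1 with rfl | rfl <;> dsimp only at hR ⊢ <;> omega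

theorem iterate_rho_pos (r s : ℕ) (x : ℤ × ℤ → ℝ) (hx : ∀ p, inR r s p → 0 < x p) (m : ℕ) :
    ∀ p, inR r s p → 0 < (rho r s)^[m] x p := by
  induction m with
  | zero => exact hx
  | succ m ih =>
    rw [Function.iterate_succ_apply']
    exact rho_pos r s _ ih

/-- The labels of a labeling, extended by `0` below the rectangle, except for a `1` at the
virtual element `(1,0)` below the minimum. -/
noncomputable def lowerExt (r s : ℕ) (x : ℤ × ℤ → ℝ) (h j : ℕ) : ℝ :=
  if j = 0 then if h = 1 then 1 else 0 else if inR r s (h, j) then x (h, j) else 0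

/-- The inverse labels of a labeling, extended by `0` above the rectangle, except for a `1`
at the virtual element `(r,s+1)` above the maximum. -/
noncomputable def upperExt (r s : ℕ) (x : ℤ × ℤ → ℝ) (h j : ℕ) : ℝ :=
  if j = s + 1 then if h = r then 1 else 0 else if inR r s (h, j) then (x (h, j))⁻¹ else 0

theorem dsum_eq (r s : ℕ) (x : ℤ × ℤ → ℝ) (h j : ℕ) (hh : h < r) (hj : j < s) :
    dsum r s x ((h + 1 : ℕ), (j + 1 : ℕ)) =
      lowerExt r s x h (j + 1) + lowerExt r s x (h + 1) j := by
  rcases h with _ | h <;> rcases j with _ | j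
  · simp [dsum, downSet, lowerExt, inR, Finset.filter_insert, Finset.filter_singleton]
  · have h1 : (j : ℤ) + 1 ≤ s := by omega
    have h2 : (1 : ℤ) ≤ r := by omega
    have h3 : (0 : ℤ) ≤ j := by omega
    simp [dsum, downSet, lowerExt, inR, Finset.filter_insert, Finset.filter_singleton, *]
  · have h1 : (h : ℤ) + 1 ≤ r := by omega
    have h2 : (1 : ℤ) ≤ s := by omega
    have h3 : (0 : ℤ) ≤ h := by omega
    simp [dsum, downSet, lowerExt, inR, Finset.filter_insert, Finset.filter_singleton, *]
  · have h1 : (h : ℤ) + 1 ≤ r := by omega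
    have h1' : (h : ℤ) + 1 + 1 ≤ r := by omega
    have h2 : (j : ℤ) + 1 ≤ s := by omega
    have h2' : (j : ℤ) + 1 + 1 ≤ s := by omega
    have h3 : (0 : ℤ) ≤ h := by omega
    have h4 : (0 : ℤ) ≤ j := by omega
    have h5 : (0 : ℤ) ≤ h + 1 := by omega
    have h6 : (0 : ℤ) ≤ j + 1 := by omega
    simp [dsum, downSet, lowerExt, inR, Finset.filter_insert, Finset.filter_singleton, *]

theorem usum_eq (r s : ℕ) (x : ℤ × ℤ → ℝ) (h j : ℕ) (hh : h < r) (hj : j < s) :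
    usum r s x ((h + 1 : ℕ), (j + 1 : ℕ)) =
      (upperExt r s x (h + 2) (j + 1) + upperExt r s x (h + 1) (j + 2))⁻¹ := by
  have h1 : (h : ℤ) + 1 ≤ r := by omega
  have h2 : (j : ℤ) + 1 ≤ s := by omega
  have h3 : (0 : ℤ) ≤ h := by omega
  have h4 : (0 : ℤ) ≤ j := by omega
  have h5 : (0 : ℤ) ≤ h + 1 := by omega
  have h6 : (0 : ℤ) ≤ j + 1 := by omega
  have h7 : j ≠ s := by omega
  have h10 : 1 ≤ r := by omega
  have h11 : 1 ≤ s := by omega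
  have e1 : (h : ℤ) + 1 + 1 = h + 2 := by ring
  have e2 : (j : ℤ) + 1 + 1 = j + 2 := by ring
  have h8 : (1 : ℤ) ≤ h + 2 := by omega
  have h9 : (1 : ℤ) ≤ j + 2 := by omega
  by_cases hr : h + 1 = r <;> by_cases hs : j + 1 = s
  · have k1 : ¬ (h : ℤ) + 2 ≤ r := by omega
    have k2 : ¬ (j : ℤ) + 2 ≤ s := by omega
    simp [usum, upSet, upperExt, inR, Finset.filter_insert, Finset.filter_singleton, *]
  · have k1 : ¬ (h : ℤ) + 2 ≤ r := by omega
    have k2 : (j : ℤ) + 2 ≤ s := by omega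
    simp [usum, upSet, upperExt, inR, Finset.filter_insert, Finset.filter_singleton, *]
  · have k1 : (h : ℤ) + 2 ≤ r := by omega
    have k2 : ¬ (j : ℤ) + 2 ≤ s := by omega
    simp [usum, upSet, upperExt, inR, Finset.filter_insert, Finset.filter_singleton, *]
  · have k1 : (h : ℤ) + 2 ≤ r := by omega
    have k2 : (j : ℤ) + 2 ≤ s := by omega
    simp [usum, upSet, upperExt, inR, Finset.filter_insert, Finset.filter_singleton, *]

/-- The data `x m h j` (labels at time `m`) and `z m h j` (inverse labels at time `m`) of a
forward orbit of birational rowmotion on `[r] × [s]`, together with boundary values. -/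
structure IsOrbit (r s : ℕ) (x z : ℕ → ℕ → ℕ → ℝ) : Prop where
  pos : ∀ m h j, h < r → j < s → 0 < x m (h + 1) (j + 1)
  inv : ∀ m h j, h < r → j < s → z m (h + 1) (j + 1) = (x m (h + 1) (j + 1))⁻¹
  left : ∀ m j, 1 ≤ j → x m 0 j = 0
  bot : ∀ m h, x m h 0 = if h = 1 then 1 else 0
  right : ∀ m j, j ≤ s → z m (r + 1) j = 0
  top : ∀ m h, z m h (s + 1) = if h = r then 1 else 0
  step : ∀ m h j, h < r → j < s →
    x (m + 1) (h + 1) (j + 1) * x m (h + 1) (j + 1) *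
      (z (m + 1) (h + 2) (j + 1) + z (m + 1) (h + 1) (j + 2)) =
    x m h (j + 1) + x m (h + 1) j

theorem isOrbit_iterate_rho (r s : ℕ) (y : ℤ × ℤ → ℝ) (hy : ∀ p, inR r s p → 0 < y p) :
    IsOrbit r s (fun m => lowerExt r s ((rho r s)^[m] y))
      (fun m => upperExt r s ((rho r s)^[m] y)) := by
  have hR : ∀ h j : ℕ, h < r → j < s → inR r s ((h + 1 : ℕ), (j + 1 : ℕ)) := by
    intro h j hh hj
    refine ⟨?_, ?_, ?_, ?_⟩ <;> push_cast <;> omega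
  have hx : ∀ (w : ℤ × ℤ → ℝ) (h j : ℕ), h < r → j < s →
      lowerExt r s w (h + 1) (j + 1) = w ((h + 1 : ℕ), (j + 1 : ℕ)) := by
    intro w h j hh hj
    simp only [lowerExt, if_pos (hR h j hh hj), if_neg (Nat.succ_ne_zero j)]
  refine ⟨?_, ?_, ?_, ?_, ?_, ?_, ?_⟩
  · intro m h j hh hj
    simp only [hx _ h j hh hj]
    exact iterate_rho_pos r s y hy m _ (hR h j hh hj)
  · intro m h j hh hj
    simp only [hx _ h j hh hj]
    have : j + 1 ≠ s + 1 := by omega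
    simp only [upperExt, if_pos (hR h j hh hj), if_neg this]
  · intro m j hj
    have : j ≠ 0 := by omega
    simp [lowerExt, inR, this]
  · intro m h
    simp [lowerExt]
  · intro m j hj
    have : j ≠ s + 1 := by omega
    simp [upperExt, inR, this]
  · intro m h
    simp [upperExt]
  · intro m h j hh hj
    simp only [hx _ h j hh hj]
    have hp := iterate_rho_pos r s y hy m _ (hR h j hh hj)
    have hu := usum_pos r s ((rho r s)^[m + 1] y) ((h + 1 : ℕ), (j + 1 : ℕ))
      fun q hq => iterate_rho_pos r s y hy (m + 1) q (Finset.mem_filter.1 hq).2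
    have key := rho_apply r s ((rho r s)^[m] y) _ (hR h j hh hj)
    rw [← Function.iterate_succ_apply' (rho r s) m y] at key
    rw [usum_eq r s _ h j hh hj] at hu key
    rw [dsum_eq r s _ h j hh hj] at key
    rw [Nat.succ_eq_add_one] at key
    have hS := inv_pos.1 hu
    rw [key]
    field_simp

/-! ### Lattice path sums -/

/-- The sum, over all lattice paths from row `i` of column `1` to row `h` of column `j`, of the
product of the weights `a` along the path, where `a h j` is the weight of `(h+1,j+1)`. -/
def pathSum (a : ℕ → ℕ → ℝ) (i : ℕ) : ℕ → ℕ → ℝ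
  | 0, h => if h = i then 1 else 0
  | _ + 1, 0 => 0
  | j + 1, h + 1 => a h j * (pathSum a i (j + 1) h + pathSum a i j (h + 1))

theorem pathSum_row_zero (a : ℕ → ℕ → ℝ) (i j : ℕ) (hi : 1 ≤ i) : pathSum a i j 0 = 0 := by
  cases j with
  | zero => simp [pathSum]; omega
  | succ j => simp [pathSum]

theorem pathSum_row_one (a : ℕ → ℕ → ℝ) (i j : ℕ) (hi : 2 ≤ i) : pathSum a i j 1 = 0 := by
  induction j with
  | zero => simp [pathSum]; omega
  | succ j ih => simp [pathSum, ih]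

/-- Two bidiagonal linear recursions intertwined by the relation `r h * g' h = g h * r (h+1)`. -/
theorem bidiagonal_exchange (n : ℕ) (g g' r W V U U' : ℕ → ℝ)
    (hW : W 0 = 0) (hV : V 0 = 0) (hU : U 0 = 0)
    (comm : ∀ h < n, r (h + 1) * g' (h + 1) = g (h + 1) * r (h + 2))
    (hWV : ∀ h < n, W (h + 1) * (g' (h + 1) + r (h + 2)) - W h = V (h + 1))
    (hVU : ∀ h < n, V (h + 1) * g (h + 1) - V h = U' (h + 1))
    (hUU : ∀ h < n, U (h + 1) * (g (h + 1) + r (h + 1)) - U h = U' (h + 1))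
    (hne : ∀ h < n, g (h + 1) + r (h + 1) ≠ 0) :
    ∀ h < n, W (h + 1) * g' (h + 1) - W h = U (h + 1) := by
  intro h
  induction h with
  | zero =>
    intro hn
    apply mul_right_cancel₀ (hne 0 hn)
    have h1 := hWV 0 hn
    have h2 := hVU 0 hn
    have h3 := hUU 0 hn
    have h4 := comm 0 hn
    simp only [hW, hV, hU, sub_zero, zero_add] at *
    linear_combination W 1 * h4 + g 1 * h1 + h2 - h3
  | succ h ih =>
    intro hn
    apply mul_right_cancel₀ (hne _ hn)
    have h0 := ih (by omega)
    have h1 := hWV (h + 1) hn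
    have h1' := hWV h (by omega)
    have h2 := hVU (h + 1) hn
    have h3 := hUU (h + 1) hn
    have h4 := comm (h + 1) hn
    linear_combination W (h + 2) * h4 + g (h + 2) * h1 + h2 - h3 - h1' + h0

namespace IsOrbit

variable {r s : ℕ} {x z : ℕ → ℕ → ℕ → ℝ}

theorem mul_inv (H : IsOrbit r s x z) (m h j : ℕ) (hh : h < r) (hj : j < s) :
    x m (h + 1) (j + 1) * z m (h + 1) (j + 1) = 1 := by
  rw [H.inv m h j hh hj]
  exact mul_inv_cancel₀ (H.pos m h j hh hj).ne'

theorem z_pos (H : IsOrbit r s x z) (m h j : ℕ) (hh : h < r) (hj : j < s) :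
    0 < z m (h + 1) (j + 1) := by
  rw [H.inv m h j hh hj]
  exact inv_pos.2 (H.pos m h j hh hj)

theorem lower_pos (H : IsOrbit r s x z) (m h j : ℕ) (hh : h < r) (hj : j < s) :
    0 < x m h (j + 1) + x m (h + 1) j := by
  rcases h with _ | h <;> rcases j with _ | j
  · simp [H.left, H.bot]
  · simpa [H.left] using H.pos m 0 j hh (by omega)
  · simpa [H.bot] using H.pos m h 0 (by omega) hj
  · exact add_pos (H.pos m h _ (by omega) hj) (H.pos m _ j hh (by omega))

end IsOrbit

/-- The down-slack of an orbit at `(h+1,j+1)`. -/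
noncomputable def slack (x : ℕ → ℕ → ℕ → ℝ) (m h j : ℕ) : ℝ :=
  x m (h + 1) (j + 1) / (x m h (j + 1) + x m (h + 1) j)

namespace IsOrbit

variable {r s : ℕ} {x z : ℕ → ℕ → ℕ → ℝ}

theorem slack_mul_lower (H : IsOrbit r s x z) (m h j : ℕ) (hh : h < r) (hj : j < s) :
    slack x m h j * (x m h (j + 1) + x m (h + 1) j) = x m (h + 1) (j + 1) :=
  div_mul_cancel₀ _ (H.lower_pos m h j hh hj).ne'

theorem slack_mul_lower_mul (H : IsOrbit r s x z) (m h j : ℕ) (hh : h < r) (hj : j < s) :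
    slack x m h j * ((x m h (j + 1) + x m (h + 1) j) * z m (h + 1) (j + 1)) = 1 := by
  rw [← mul_assoc, H.slack_mul_lower m h j hh hj, H.mul_inv m h j hh hj]

theorem slack_mul_upper (H : IsOrbit r s x z) (m h j : ℕ) (hh : h < r) (hj : j < s) :
    slack x m h j * (x (m + 1) (h + 1) (j + 1) *
      (z (m + 1) (h + 2) (j + 1) + z (m + 1) (h + 1) (j + 2))) = 1 := by
  have h1 := H.step m h j hh hj
  have h2 := H.slack_mul_lower m h j hh hj
  apply mul_left_cancel₀ (H.pos m h j hh hj).ne'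
  linear_combination slack x m h j * h1 + h2

/-- Labels are path sums of down-slacks from the minimum. -/
theorem pathSum_slack_one (H : IsOrbit r s x z) (m j : ℕ) (hj : j ≤ s) :
    ∀ h ≤ r, pathSum (slack x m) 1 j h = x m h j := by
  induction j with
  | zero => intro h _; simp [pathSum, H.bot]
  | succ j ih =>
    intro h
    induction h with
    | zero => intro _; simp [pathSum, H.left]
    | succ h ih' =>
      intro hh
      rw [pathSum, ih' (by omega), ih (by omega) _ hh, H.slack_mul_lower m h j hh hj]

/-- Inverse labels one step later are path sums of down-slacks to the maximum. -/
theorem pathSum_slack_last (H : IsOrbit r s x z) (m i : ℕ) (hi : 1 ≤ i) (hir : i ≤ r) :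
    pathSum (slack x m) i s r = z (m + 1) i 1 := by
  have aux : ∀ j ≤ s, ∑ h ∈ Finset.range r,
      pathSum (slack x m) i j (h + 1) * z (m + 1) (h + 1) (j + 1) = z (m + 1) i 1 := by
    intro j
    induction j with
    | zero =>
      intro _
      rw [Finset.sum_eq_single_of_mem (i - 1) (Finset.mem_range.2 (by omega))]
      · rw [Nat.sub_add_cancel hi]; simp [pathSum]
      · intro h _ hne
        have : h + 1 ≠ i := by omega
        simp [pathSum, this]
    | succ j ih =>
      intro hj
      rw [← ih (by omega), ← sub_eq_zero, ← Finset.sum_sub_distrib]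
      have := Finset.sum_range_sub
        (fun h => - (pathSum (slack x m) i (j + 1) h * z (m + 1) (h + 1) (j + 1))) r
      rw [H.right _ _ hj, pathSum_row_zero _ _ _ hi, mul_zero, zero_mul, neg_zero, sub_zero] at this
      rw [← this]
      refine Finset.sum_congr rfl fun h hh => ?_
      have hh := Finset.mem_range.1 hh
      have h1 := H.slack_mul_upper m h j hh hj
      have h2 := H.mul_inv (m + 1) h j hh hj
      rw [pathSum]
      set P := pathSum (slack x m) i (j + 1) h + pathSum (slack x m) i j (h + 1) with hP
      linear_combination P * z (m + 1) (h + 1) (j + 1) * h1 -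
        P * slack x m h j * (z (m + 1) (h + 2) (j + 1) + z (m + 1) (h + 1) (j + 2)) * h2 +
        z (m + 1) (h + 1) (j + 1) * hP
  rw [← aux s le_rfl]
  obtain ⟨r, rfl⟩ : ∃ r', r = r' + 1 := ⟨r - 1, by omega⟩
  rw [Finset.sum_eq_single_of_mem r (Finset.mem_range.2 (by omega))]
  · simp [H.top]
  · intro h _ hne
    simp [H.top, hne]

/-- Path sums across the rectangle are invariant under shifting both time and row by one. -/
theorem pathSum_slack_shift (H : IsOrbit r s x z) (m i : ℕ) (hi : 1 ≤ i) (hs : 1 ≤ s) :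
    ∀ h < r, pathSum (slack x (m + 1)) (i + 1) s (h + 1) = pathSum (slack x m) i s h := by
  set V := fun j h => pathSum (slack x (m + 1)) (i + 1) j (h + 1) with hVdef
  set U := fun j h => pathSum (slack x m) i j h with hUdef
  set g := fun j h => x (m + 1) h j * z (m + 1) (h + 1) j with hg
  set ρ := fun j h => x (m + 1) h j * z (m + 1) h (j + 1) with hρ
  have hV0 : ∀ j, V j 0 = 0 := fun j => pathSum_row_one _ _ _ (by omega)
  have hU0 : ∀ j, U j 0 = 0 := fun j => pathSum_row_zero _ _ _ hi
  have hV : ∀ j < s, ∀ h < r - 1,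
      V (j + 1) (h + 1) * (g (j + 1) (h + 1) + ρ j (h + 2)) - V (j + 1) h = V j (h + 1) := by
    intro j hj h hh
    have h1 := H.slack_mul_lower_mul (m + 1) (h + 1) j (by omega) hj
    have h2 : V (j + 1) (h + 1) = slack x (m + 1) (h + 1) j * (V (j + 1) h + V j (h + 1)) := by
      simp only [hVdef, pathSum]
    rw [h2]
    simp only [hg, hρ]
    linear_combination (V (j + 1) h + V j (h + 1)) * h1
  have hU : ∀ j < s, ∀ h < r - 1,
      U (j + 1) (h + 1) * (g (j + 1) (h + 1) + ρ (j + 1) (h + 1)) - U (j + 1) h = U j (h + 1) := by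
    intro j hj h hh
    have h1 := H.slack_mul_upper m h j (by omega) hj
    have h2 : U (j + 1) (h + 1) = slack x m h j * (U (j + 1) h + U j (h + 1)) := by
      simp only [hUdef, pathSum]
    rw [h2]
    simp only [hg, hρ]
    linear_combination (U (j + 1) h + U j (h + 1)) * h1
  have hgpos : ∀ j < s, ∀ h < r - 1, 0 < g (j + 1) (h + 1) := fun j hj h hh =>
    mul_pos (H.pos _ _ _ (by omega) hj) (H.z_pos _ (h + 1) _ (by omega) hj)
  have main : ∀ j < s, ∀ h < r - 1,
      V (j + 1) (h + 1) * g (j + 1) (h + 1) - V (j + 1) h = U j (h + 1) := by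
    intro j
    induction j with
    | zero =>
      intro hj h hh
      have h1 := hV 0 hj h hh
      have h2 : ρ 0 (h + 2) = 0 := by simp [hρ, H.bot]
      have h3 : V 0 (h + 1) = U 0 (h + 1) := by simp [hVdef, hUdef, pathSum]
      rw [h2, add_zero, h3] at h1
      exact h1
    | succ j ih =>
      intro hj
      refine bidiagonal_exchange (r - 1) (g (j + 1)) (g (j + 2)) (ρ (j + 1)) (V (j + 2))
        (V (j + 1)) (U (j + 1)) (U j) (hV0 _) (hV0 _) (hU0 _) ?_ (hV (j + 1) hj)
        (ih (by omega)) (hU j (by omega)) ?_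
      · intro h hh
        have h1 := H.mul_inv (m + 1) h (j + 1) (by omega) hj
        have h2 := H.mul_inv (m + 1) (h + 1) j (by omega) (by omega)
        simp only [hg, hρ]
        linear_combination x (m + 1) (h + 1) (j + 1) * z (m + 1) (h + 2) (j + 2) * (h1 - h2)
      · intro h hh
        exact (add_pos (hgpos j (by omega) h hh)
          (mul_pos (H.pos _ _ _ (by omega) (by omega)) (H.z_pos _ _ (j + 1) (by omega) hj))).ne'
  obtain ⟨s, rfl⟩ : ∃ s', s = s' + 1 := ⟨s - 1, by omega⟩
  intro h
  induction h with
  | zero => intro _; exact (hV0 _).trans (hU0 _).symm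
  | succ h ih =>
    intro hh
    have h0 : V (s + 1) h = U (s + 1) h := ih (by omega)
    have h1 := main s (by omega) h (by omega)
    have h2 := hU s (by omega) h (by omega)
    have h3 : ρ (s + 1) (h + 1) = 0 := by
      have : h + 1 ≠ r := by omega
      simp [hρ, H.top, this]
    rw [h3, add_zero] at h2
    apply mul_right_cancel₀ (hgpos s (by omega) h (by omega)).ne'
    linear_combination h1 - h2 + h0

/-- Reciprocity along the edge `j = 1` of the rectangle. -/
theorem reciprocity_edge (H : IsOrbit r s x z) (hs : 1 ≤ s) (m k t : ℕ) (hk : 1 ≤ k)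
    (hkt : k + t = r) : z (m + t + 1) (t + 1) 1 = x m k s := by
  have aux : ∀ t, k + t ≤ r →
      pathSum (slack x (m + t)) (1 + t) s (k + t) = pathSum (slack x m) 1 s k := by
    intro t
    induction t with
    | zero => intro _; rfl
    | succ t ih =>
      intro ht
      rw [← ih (by omega)]
      exact H.pathSum_slack_shift (m + t) (1 + t) (by omega) hs (k + t) (by omega)
  rw [← H.pathSum_slack_one m s le_rfl k (by omega), ← aux t hkt.le, hkt, Nat.add_comm 1 t,
    H.pathSum_slack_last (m + t) (t + 1) (by omega) (by omega)]

/-- Reciprocity: the label of `(h,j)` is the inverse of the label of the antipodal element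
`h + j - 1` steps earlier. -/
theorem reciprocity (H : IsOrbit r s x z) (hs : 1 ≤ s) (j : ℕ) (hj : j < s) :
    ∀ m h h' j', h + h' = r + 1 → j + 1 + j' = s + 1 →
      (1 ≤ h → z (m + h + j) h (j + 1) = x m h' j') ∧
      (1 ≤ h' → x (m + h + j) h (j + 1) = z m h' j') := by
  have dual : ∀ n m h h' j j', h + h' = r + 1 → j + 1 + j' = s + 1 → 1 ≤ j' →
      (1 ≤ h → z n h (j + 1) = x m h' j') → 1 ≤ h' → x n h (j + 1) = z m h' j' := by
    intro n m h h' j j' hh hjj hj' hz hh'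
    rcases h with _ | h
    · rw [H.left _ _ (by omega), show h' = r + 1 by omega, H.right _ _ (by omega)]
    · have h1 := hz (by omega)
      obtain ⟨k, rfl⟩ : ∃ k, h' = k + 1 := ⟨h' - 1, by omega⟩
      obtain ⟨l, rfl⟩ : ∃ l, j' = l + 1 := ⟨j' - 1, by omega⟩
      rw [H.inv _ _ _ (by omega) (by omega)] at h1 ⊢
      rw [← h1, inv_inv]
  induction j using Nat.strong_induction_on with
  | _ j ih =>
    intro m h h' j' hh hjj
    suffices hz : 1 ≤ h → z (m + h + j) h (j + 1) = x m h' j' from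
      ⟨hz, dual _ _ _ _ _ _ hh hjj (by omega) hz⟩
    intro h1
    obtain ⟨t, rfl⟩ : ∃ t, h = t + 1 := ⟨h - 1, by omega⟩
    rcases Nat.eq_zero_or_pos h' with rfl | hh'
    · rw [show t + 1 = r + 1 by omega, H.right _ _ (by omega), H.left _ _ (by omega)]
    obtain ⟨k, rfl⟩ : ∃ k, h' = k + 1 := ⟨h' - 1, by omega⟩
    rcases j with _ | j
    · rw [show j' = s by omega]
      exact H.reciprocity_edge hs m (k + 1) t (by omega) (by omega)
    · have a1 := H.step (m + (t + 1) + j) t j (by omega) (by omega)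
      have a2 := H.step m k j' (by omega) (by omega)
      have b1 := (ih j (by omega) (by omega) m (t + 1) (k + 1) (j' + 1) hh (by omega)).2 (by omega)
      have b2 := (ih j (by omega) (by omega) (m + 1) (t + 1) (k + 1) (j' + 1) hh
        (by omega)).2 (by omega)
      have b3 := (ih j (by omega) (by omega) m (t + 2) k (j' + 1) (by omega)
        (by omega)).1 (by omega)
      have b4 := (ih j (by omega) (by omega) (m + 1) t (k + 2) (j' + 1) (by omega)
        (by omega)).2 (by omega)
      have b5 : x (m + (t + 1) + j) (t + 1) j = z (m + 1) (k + 1) (j' + 2) := by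
        rcases j with _ | j
        · rw [H.bot, show j' + 2 = s + 1 by omega, H.top]
          exact if_congr (by omega) rfl rfl
        · have := (ih j (by omega) (by omega) (m + 1) (t + 1) (k + 1) (j' + 2) hh
            (by omega)).2 (by omega)
          rw [← this]
          congr 1
          omega
      rw [show m + 1 + (t + 1) + j = m + (t + 1) + j + 1 by omega] at b2
      rw [show m + (t + 2) + j = m + (t + 1) + j + 1 by omega] at b3
      rw [show m + 1 + t + j = m + (t + 1) + j by omega] at b4
      have c1 := H.mul_inv m k j' (by omega) (by omega)
      have c2 := H.mul_inv (m + 1) k j' (by omega) (by omega)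
      rw [b1, b2, b3, b4, b5] at a1
      rw [show m + (t + 1) + (j + 1) = m + (t + 1) + j + 1 by omega]
      generalize z (m + (t + 1) + j + 1) (t + 1) (j + 1 + 1) = Z at a1 ⊢
      linear_combination x (m + 1) (k + 1) (j' + 1) * x m (k + 1) (j' + 1) * a1 + a2 -
        (x m k (j' + 1) + Z) * (c1 + z m (k + 1) (j' + 1) * x m (k + 1) (j' + 1) * c2)

theorem periodic (H : IsOrbit r s x z) (m h j : ℕ) (hh : h < r) (hj : j < s) :
    x (m + (r + s)) (h + 1) (j + 1) = x m (h + 1) (j + 1) := by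
  have h1 := (H.reciprocity (by omega) j hj (m + (r - h) + (s - j - 1)) (h + 1) (r - h) (s - j)
    (by omega) (by omega)).2 (by omega)
  have h2 := (H.reciprocity (by omega) (s - j - 1) (by omega) m (r - h) (h + 1) (j + 1)
    (by omega) (by omega)).1 (by omega)
  rw [show s - j - 1 + 1 = s - j by omega] at h2
  rw [← h2, ← h1]
  congr 1
  omega

end IsOrbit

/-- **Theorem 3.6(c) (Grinberg–Roby).** Birational rowmotion on the rectangle
`R = [r] × [s]` satisfies `ρ^{r+s}(y) = y` for every positive labeling `y`; i.e. its
order divides `r + s`. -/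
theorem rowmotion_order (r s : ℕ) (hr : 1 ≤ r) (hs : 1 ≤ s)
    (y : ℤ × ℤ → ℝ) (hy : ∀ p, inR r s p → 0 < y p) (p : ℤ × ℤ) (hp : inR r s p) :
    (rho r s)^[r + s] y p = y p := by
  obtain ⟨a, b⟩ := p
  obtain ⟨h1, h2, h3, h4⟩ := hp
  dsimp only at h1 h2 h3 h4
  obtain ⟨h, rfl⟩ : ∃ h : ℕ, a = (h + 1 : ℕ) := ⟨(a - 1).toNat, by omega⟩
  obtain ⟨j, rfl⟩ : ∃ j : ℕ, b = (j + 1 : ℕ) := ⟨(b - 1).toNat, by omega⟩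
  have key := (isOrbit_iterate_rho r s y hy).periodic 0 h j (by omega) (by omega)
  have hR : inR r s ((h + 1 : ℕ), (j + 1 : ℕ)) := ⟨h1, h2, h3, h4⟩
  simpa only [lowerExt, if_pos hR, if_neg (Nat.succ_ne_zero j), Nat.zero_add,
    Function.iterate_zero, id_eq] using key

end Paper
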